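/- arXiv:2003.07534 — 2 statements merged into one kernel-verified Lean document; each statement's English description precedes it below -/
import Mathlib

section
/- Let m ≥ 3 and let A, B ∈ F_2^m be such that supp(A) ∩ supp(B) = ∅ and 0 < |B| < |A|. Let D = (Δ_A ∪ Δ_B) \ {0}. Then the binary linear code C_D has length 2^{|A|} + 2^{|B|} − 2, dimension |A| + |B| over F_2, and minimum distance 2^{|B|−1}; moreover C_D is a three-weight code having exactly 2^{|B|} − 1 codewords of weight 2^{|B|−1}, exactly 2^{|A|} − 1 codewords of weight 2^{|A|−1}, exactly (2^{|B|} − 1)(2^{|A|} − 1) codewords of weight 2^{|B|−1} + 2^{|A|−1}, and no other nonzero weights. -/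
open Finset

def supp {m : ℕ} (v : Fin m → ZMod 2) : Finset (Fin m) :=
  Finset.univ.filter fun i => v i ≠ 0

def wt {m : ℕ} (v : Fin m → ZMod 2) : ℕ := (supp v).card

def delta {m : ℕ} (A : Fin m → ZMod 2) : Finset (Fin m → ZMod 2) :=
  Finset.univ.filter fun v => supp v ⊆ supp A

def deltaT {m : ℕ} (T : Finset (Fin m)) : Finset (Fin m → ZMod 2) :=
  Finset.univ.filter fun v => supp v ⊆ T

def hwt {ι : Type*} [Fintype ι] (c : ι → ZMod 2) : ℕ :=
  (Finset.univ.filter fun i => c i ≠ 0).card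

def cw {m : ℕ} (D : Finset (Fin m → ZMod 2)) (u : Fin m → ZMod 2) : ↥D → ZMod 2 :=
  fun g => ∑ i, u i * (g : Fin m → ZMod 2) i

def codeC {m : ℕ} (D : Finset (Fin m → ZMod 2)) :
    Submodule (ZMod 2) (↥D → ZMod 2) :=
  LinearMap.range (Matrix.mulVecLin (Matrix.of fun (g : ↥D) (i : Fin m) => (g : Fin m → ZMod 2) i))

def dualCode {ι : Type*} [Fintype ι] (C : Submodule (ZMod 2) (ι → ZMod 2)) :
    Submodule (ZMod 2) (ι → ZMod 2) where
  carrier := {w | ∀ c ∈ C, ∑ i, w i * c i = 0}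
  zero_mem' := by simp
  add_mem' := by
    intro a b ha hb c hc
    have h := congrArg₂ (· + ·) (ha c hc) (hb c hc)
    simpa [add_mul, Finset.sum_add_distrib] using h
  smul_mem' := by
    intro r w hw c hc
    have h := congrArg (r * ·) (hw c hc)
    simpa [Finset.mul_sum, mul_assoc] using h

def isMinDist {ι : Type*} [Fintype ι] (C : Set (ι → ZMod 2)) (d : ℕ) : Prop :=
  (∃ c ∈ C, c ≠ 0 ∧ hwt c = d) ∧ ∀ c ∈ C, c ≠ 0 → d ≤ hwt c

def chi {m : ℕ} (u v : Fin m → ZMod 2) : ℤ :=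
  if supp u ∩ supp v = ∅ then 1 else 0

section HelperLemmas

variable {m : ℕ}

theorem mem_deltaT {T : Finset (Fin m)} {v : Fin m → ZMod 2} :
    v ∈ deltaT T ↔ ∀ i ∉ T, v i = 0 := by
  simp only [deltaT, supp, Finset.mem_filter, Finset.mem_univ, true_and, Finset.subset_iff]
  exact forall_congr' fun i => not_imp_comm

theorem card_deltaT (T : Finset (Fin m)) : (deltaT T).card = 2 ^ T.card := by
  have h : deltaT T =
      Fintype.piFinset fun i => if i ∈ T then (Finset.univ : Finset (ZMod 2)) else {0} := by
    ext v
    rw [mem_deltaT, Fintype.mem_piFinset]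
    refine forall_congr' fun i => ?_
    by_cases hi : i ∈ T <;> simp [hi]
  have hc : ∀ i, (if i ∈ T then (Finset.univ : Finset (ZMod 2)) else {0}).card
      = if i ∈ T then 2 else 1 := by
    intro i
    split_ifs <;> simp [ZMod.card]
  rw [h, Fintype.card_piFinset, Finset.prod_congr rfl fun i _ => hc i]
  simp

theorem zero_mem_deltaT (T : Finset (Fin m)) : (0 : Fin m → ZMod 2) ∈ deltaT T :=
  mem_deltaT.2 fun _ _ => rfl

theorem deltaT_inter_deltaT {S T : Finset (Fin m)} (h : Disjoint S T) :
    deltaT S ∩ deltaT T = {0} := by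
  ext v
  simp only [Finset.mem_inter, mem_deltaT, Finset.mem_singleton]
  constructor
  · rintro ⟨hS, hT⟩
    funext i
    by_cases hi : i ∈ S
    · exact hT i (Finset.disjoint_left.1 h hi)
    · exact hS i hi
  · rintro rfl
    simp

theorem card_deltaT_union_deltaT {S T : Finset (Fin m)} (h : Disjoint S T) :
    (deltaT S ∪ deltaT T).card + 1 = 2 ^ S.card + 2 ^ T.card := by
  have := Finset.card_union_add_card_inter (deltaT S) (deltaT T)
  rwa [deltaT_inter_deltaT h, Finset.card_singleton, card_deltaT, card_deltaT] at this

/-- A linear form that vanishes on the coordinates in `T` is nonzero nowhere on `deltaT T`;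
any other linear form is nonzero on exactly half of it. -/
theorem card_filter_dotProduct_ne_zero (T : Finset (Fin m)) (u : Fin m → ZMod 2) :
    ((deltaT T).filter fun v => u ⬝ᵥ v ≠ 0).card
      = if ∀ i ∈ T, u i = 0 then 0 else 2 ^ (T.card - 1) := by
  split_ifs with h
  · rw [Finset.card_eq_zero, Finset.filter_eq_empty_iff]
    intro v hv
    rw [not_not]
    refine Finset.sum_eq_zero fun i _ => ?_
    by_cases hi : i ∈ T
    · rw [h i hi, zero_mul]
    · rw [mem_deltaT.1 hv i hi, mul_zero]
  · push Not at h
    obtain ⟨j, hj, huj⟩ := h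
    have hu1 : u j = 1 := by
      generalize u j = x at huj
      revert x
      decide
    have hmem : ∀ v ∈ deltaT T, v + Pi.single j 1 ∈ deltaT T := by
      intro v hv
      rw [mem_deltaT] at hv ⊢
      intro i hi
      have hij : i ≠ j := fun h => hi (h ▸ hj)
      simp [hv i hi, hij]
    have hdot : ∀ v, u ⬝ᵥ (v + Pi.single j 1) = u ⬝ᵥ v + 1 := by
      intro v
      simp [dotProduct_add, hu1]
    have hinv : ∀ v : Fin m → ZMod 2, v + Pi.single j 1 + Pi.single j 1 = v := by
      intro v
      rw [add_assoc, ← Pi.single_add, CharTwo.add_self_eq_zero, Pi.single_zero, add_zero]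
    have hflip : ∀ x : ZMod 2, x + 1 = 0 ↔ x ≠ 0 := by decide
    have hflip' : ∀ x : ZMod 2, x = 0 → x + 1 ≠ 0 := by decide
    have heq : ((deltaT T).filter fun v => u ⬝ᵥ v ≠ 0).card
        = ((deltaT T).filter fun v => ¬ u ⬝ᵥ v ≠ 0).card := by
      refine Finset.card_bij' (fun v _ => v + Pi.single j 1) (fun v _ => v + Pi.single j 1)
        ?_ ?_ (fun v _ => hinv v) (fun v _ => hinv v)
      · intro v hv
        rw [Finset.mem_filter] at hv ⊢
        refine ⟨hmem v hv.1, ?_⟩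
        rw [not_not, hdot]
        exact (hflip _).2 hv.2
      · intro v hv
        rw [Finset.mem_filter, not_not] at hv
        rw [Finset.mem_filter]
        refine ⟨hmem v hv.1, ?_⟩
        rw [hdot]
        exact hflip' _ hv.2
    have hsum := Finset.card_filter_add_card_filter_not (s := deltaT T) fun v => u ⬝ᵥ v ≠ 0
    have hpos : 0 < T.card := Finset.card_pos.2 ⟨j, hj⟩
    obtain ⟨k, hk⟩ : ∃ k, T.card = k + 1 := ⟨T.card - 1, by omega⟩
    rw [card_deltaT, ← heq, hk, pow_succ] at hsum
    rw [hk, Nat.add_sub_cancel]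
    omega

theorem hwt_cw (D : Finset (Fin m → ZMod 2)) (u : Fin m → ZMod 2) :
    hwt (cw D u) = (D.filter fun v => u ⬝ᵥ v ≠ 0).card := by
  rw [hwt, ← Finset.card_map (Function.Embedding.subtype _)]
  congr 1
  ext v
  simp only [Finset.mem_map, Finset.mem_filter, Finset.mem_univ, true_and]
  constructor
  · rintro ⟨g, hg, rfl⟩
    exact ⟨g.2, hg⟩
  · rintro ⟨hv, hne⟩
    exact ⟨⟨v, hv⟩, hne, rfl⟩

theorem hwt_cw_union {S T : Finset (Fin m)} (h : Disjoint S T) (u : Fin m → ZMod 2) :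
    hwt (cw ((deltaT S ∪ deltaT T) \ {0}) u)
      = (if ∀ i ∈ S, u i = 0 then 0 else 2 ^ (S.card - 1))
        + if ∀ i ∈ T, u i = 0 then 0 else 2 ^ (T.card - 1) := by
  rw [hwt_cw, ← card_filter_dotProduct_ne_zero, ← card_filter_dotProduct_ne_zero,
    ← Finset.card_union_of_disjoint]
  · congr 1
    ext v
    simp only [Finset.mem_filter, Finset.mem_sdiff, Finset.mem_union, Finset.mem_singleton]
    constructor
    · tauto
    · intro hv
      have hv0 : v ≠ 0 := by
        rintro rfl
        simp at hv
      tauto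
  · rw [Finset.disjoint_left]
    intro v hS hT
    rw [Finset.mem_filter] at hS hT
    have hv : v ∈ deltaT S ∩ deltaT T := Finset.mem_inter.2 ⟨hS.1, hT.1⟩
    rw [deltaT_inter_deltaT h, Finset.mem_singleton] at hv
    subst hv
    simp at hS

theorem cw_eq_mulVecLin (D : Finset (Fin m → ZMod 2)) (u : Fin m → ZMod 2) :
    cw D u = Matrix.mulVecLin
      (Matrix.of fun (g : ↥D) (i : Fin m) => (g : Fin m → ZMod 2) i) u := by
  funext g
  simp [cw, Matrix.mulVec, dotProduct, mul_comm]

theorem hwt_eq_zero {ι : Type*} [Fintype ι] {c : ι → ZMod 2} : hwt c = 0 ↔ c = 0 := by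
  simp [hwt, Finset.filter_eq_empty_iff, funext_iff]

theorem coe_codeC_eq_image {S T : Finset (Fin m)} (D : Finset (Fin m → ZMod 2))
    (hD : D = (deltaT S ∪ deltaT T) \ {0}) :
    (codeC D : Set (↥D → ZMod 2)) = cw D '' (deltaT (S ∪ T)) := by
  ext c
  simp only [codeC, SetLike.mem_coe, LinearMap.mem_range, Set.mem_image, ← cw_eq_mulVecLin]
  constructor
  · rintro ⟨u, rfl⟩
    refine ⟨fun i => if i ∈ S ∪ T then u i else 0, mem_deltaT.2 fun i hi => if_neg hi, ?_⟩
    funext g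
    refine Finset.sum_congr rfl fun i _ => ?_
    have hg : (g : Fin m → ZMod 2) ∈ (deltaT S ∪ deltaT T) \ {0} := hD ▸ g.2
    by_cases hi : i ∈ S ∪ T
    · simp only [if_pos hi]
    · have h0 : (g : Fin m → ZMod 2) i = 0 := by
        rw [Finset.notMem_union] at hi
        rcases Finset.mem_union.1 (Finset.mem_sdiff.1 hg).1 with h | h
        · exact mem_deltaT.1 h i hi.1
        · exact mem_deltaT.1 h i hi.2
      rw [h0, mul_zero, mul_zero]
  · rintro ⟨u, -, rfl⟩
    exact ⟨u, rfl⟩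

theorem injOn_cw {S T : Finset (Fin m)} (h : Disjoint S T) (D : Finset (Fin m → ZMod 2))
    (hD : D = (deltaT S ∪ deltaT T) \ {0}) :
    Set.InjOn (cw D) (deltaT (S ∪ T)) := by
  intro u hu v hv huv
  rw [Finset.mem_coe, mem_deltaT] at hu hv
  have h0 : hwt (cw D (u - v)) = 0 := by
    rw [hwt_eq_zero, cw_eq_mulVecLin, map_sub, ← cw_eq_mulVecLin, ← cw_eq_mulVecLin, huv,
      sub_self]
  subst hD
  rw [hwt_cw_union h, Nat.add_eq_zero_iff] at h0
  have aux : ∀ (P : Prop) [Decidable P] (k : ℕ), (if P then 0 else 2 ^ k) = 0 → P := by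
    intro P _ k hP
    by_contra hn
    simp [hn] at hP
  funext i
  by_cases hS : i ∈ S
  · exact sub_eq_zero.1 (aux _ _ h0.1 i hS)
  by_cases hT : i ∈ T
  · exact sub_eq_zero.1 (aux _ _ h0.2 i hT)
  have hi : i ∉ S ∪ T := Finset.notMem_union.2 ⟨hS, hT⟩
  rw [hu i hi, hv i hi]

theorem ncard_codeC_hwt_eq {S T : Finset (Fin m)} (h : Disjoint S T)
    (D : Finset (Fin m → ZMod 2)) (hD : D = (deltaT S ∪ deltaT T) \ {0}) (w : ℕ) :
    {c : ↥D → ZMod 2 | c ∈ codeC D ∧ hwt c = w}.ncard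
      = ((deltaT (S ∪ T)).filter fun u => hwt (cw D u) = w).card := by
  have himg : {c : ↥D → ZMod 2 | c ∈ codeC D ∧ hwt c = w}
      = cw D '' ((deltaT (S ∪ T)).filter fun u => hwt (cw D u) = w) := by
    ext c
    rw [Set.mem_ofPred_eq, ← SetLike.mem_coe, coe_codeC_eq_image D hD]
    simp only [Set.mem_image, Finset.mem_coe, Finset.mem_filter]
    constructor
    · rintro ⟨⟨u, hu, rfl⟩, hw⟩
      exact ⟨u, ⟨hu, hw⟩, rfl⟩
    · rintro ⟨u, ⟨hu, hw⟩, rfl⟩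
      exact ⟨⟨u, hu, rfl⟩, hw⟩
  rw [himg, Set.InjOn.ncard_image, Set.ncard_coe_finset]
  exact (injOn_cw h D hD).mono fun u hu => (Finset.mem_filter.1 hu).1

theorem finrank_codeC {S T : Finset (Fin m)} (h : Disjoint S T)
    (D : Finset (Fin m → ZMod 2)) (hD : D = (deltaT S ∪ deltaT T) \ {0}) :
    Module.finrank (ZMod 2) (codeC D) = S.card + T.card := by
  have h1 : Nat.card (codeC D) = 2 ^ (S.card + T.card) := by
    have : Nat.card (codeC D) = (codeC D : Set (↥D → ZMod 2)).ncard := rfl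
    rw [this, coe_codeC_eq_image D hD, (injOn_cw h D hD).ncard_image,
      Set.ncard_coe_finset, card_deltaT, Finset.card_union_of_disjoint h]
  rw [Module.natCard_eq_pow_finrank (K := ZMod 2), Nat.card_zmod] at h1
  exact Nat.pow_right_injective le_rfl h1

theorem mem_deltaT_left_iff {S T : Finset (Fin m)} (h : Disjoint S T)
    {u : Fin m → ZMod 2} (hu : u ∈ deltaT (S ∪ T)) :
    u ∈ deltaT S ↔ ∀ i ∈ T, u i = 0 := by
  rw [mem_deltaT] at hu ⊢
  refine ⟨fun hS i hi => hS i (Finset.disjoint_right.1 h hi), fun hT i hi => ?_⟩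
  by_cases hiT : i ∈ T
  · exact hT i hiT
  · exact hu i (Finset.notMem_union.2 ⟨hi, hiT⟩)

theorem mem_deltaT_right_iff {S T : Finset (Fin m)} (h : Disjoint S T)
    {u : Fin m → ZMod 2} (hu : u ∈ deltaT (S ∪ T)) :
    u ∈ deltaT T ↔ ∀ i ∈ S, u i = 0 :=
  mem_deltaT_left_iff h.symm (Finset.union_comm S T ▸ hu)

theorem deltaT_mono {S T : Finset (Fin m)} (h : S ⊆ T) : deltaT S ⊆ deltaT T :=
  fun _ hv => mem_deltaT.2 fun i hi => mem_deltaT.1 hv i fun hS => hi (h hS)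

theorem card_deltaT_sdiff_zero (T : Finset (Fin m)) :
    (deltaT T \ {0}).card = 2 ^ T.card - 1 := by
  rw [Finset.card_sdiff_of_subset (Finset.singleton_subset_iff.2 (zero_mem_deltaT T)),
    card_deltaT, Finset.card_singleton]

theorem card_deltaT_union_sdiff {S T : Finset (Fin m)} (h : Disjoint S T) :
    (deltaT (S ∪ T) \ (deltaT S ∪ deltaT T)).card
      = (2 ^ T.card - 1) * (2 ^ S.card - 1) := by
  have hsub : deltaT S ∪ deltaT T ⊆ deltaT (S ∪ T) :=
    Finset.union_subset (deltaT_mono Finset.subset_union_left)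
      (deltaT_mono Finset.subset_union_right)
  have hU := card_deltaT_union_deltaT h
  rw [Finset.card_sdiff_of_subset hsub, card_deltaT, Finset.card_union_of_disjoint h, pow_add]
  obtain ⟨x, hx⟩ := Nat.exists_eq_add_of_lt (Nat.two_pow_pos S.card)
  obtain ⟨y, hy⟩ := Nat.exists_eq_add_of_lt (Nat.two_pow_pos T.card)
  rw [hx, hy] at hU ⊢
  have hU' : (deltaT S ∪ deltaT T).card = x + y + 1 := by omega
  rw [hU']
  simp only [zero_add, Nat.add_sub_cancel]
  rw [Nat.sub_eq_iff_eq_add (by nlinarith)]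
  ring

theorem hwt_cw_of_mem {S T : Finset (Fin m)} (h : Disjoint S T)
    (D : Finset (Fin m → ZMod 2)) (hD : D = (deltaT S ∪ deltaT T) \ {0})
    {u : Fin m → ZMod 2} (hu : u ∈ deltaT (S ∪ T)) :
    hwt (cw D u) = (if u ∈ deltaT T then 0 else 2 ^ (S.card - 1))
      + if u ∈ deltaT S then 0 else 2 ^ (T.card - 1) := by
  subst hD
  simp only [hwt_cw_union h, mem_deltaT_left_iff h hu, mem_deltaT_right_iff h hu]

end HelperLemmas

theorem stmt5 {m : ℕ} (hm : 3 ≤ m) (A B : Fin m → ZMod 2)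
    (hdisj : supp A ∩ supp B = ∅) (hB : 0 < wt B) (hBA : wt B < wt A)
    (D : Finset (Fin m → ZMod 2)) (hD : D = (delta A ∪ delta B) \ {0}) :
    D.card = 2 ^ wt A + 2 ^ wt B - 2 ∧
    Module.finrank (ZMod 2) (codeC D) = wt A + wt B ∧
    isMinDist (codeC D : Set (↥D → ZMod 2)) (2 ^ (wt B - 1)) ∧
    {c : ↥D → ZMod 2 | c ∈ codeC D ∧ hwt c = 2 ^ (wt B - 1)}.ncard = 2 ^ wt B - 1 ∧
    {c : ↥D → ZMod 2 | c ∈ codeC D ∧ hwt c = 2 ^ (wt A - 1)}.ncard = 2 ^ wt A - 1 ∧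
    {c : ↥D → ZMod 2 | c ∈ codeC D ∧ hwt c = 2 ^ (wt B - 1) + 2 ^ (wt A - 1)}.ncard
      = (2 ^ wt B - 1) * (2 ^ wt A - 1) ∧
    ∀ c ∈ codeC D, c ≠ 0 →
      hwt c = 2 ^ (wt B - 1) ∨ hwt c = 2 ^ (wt A - 1) ∨
        hwt c = 2 ^ (wt B - 1) + 2 ^ (wt A - 1) := by
  classical
  have h : Disjoint (supp A) (supp B) := Finset.disjoint_iff_inter_eq_empty.2 hdisj
  replace hD : D = (deltaT (supp A) ∪ deltaT (supp B)) \ {0} := hD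
  simp only [wt] at *
  have hlt : 2 ^ ((supp B).card - 1) < 2 ^ ((supp A).card - 1) :=
    Nat.pow_lt_pow_right one_lt_two (by omega)
  have hpos : 0 < 2 ^ ((supp B).card - 1) := Nat.two_pow_pos _
  have hw := fun u (hu : u ∈ deltaT (supp A ∪ supp B)) => hwt_cw_of_mem h D hD hu
  have hzero : ∀ u, u ∈ deltaT (supp A) → u ∈ deltaT (supp B) → u = 0 := by
    intro u hA hB
    have := Finset.mem_inter.2 ⟨hA, hB⟩
    rwa [deltaT_inter_deltaT h, Finset.mem_singleton] at this
  have hSA : deltaT (supp A) ⊆ deltaT (supp A ∪ supp B) := deltaT_mono Finset.subset_union_left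
  have hSB : deltaT (supp B) ⊆ deltaT (supp A ∪ supp B) := deltaT_mono Finset.subset_union_right
  have h0A := zero_mem_deltaT (supp A)
  have h0B := zero_mem_deltaT (supp B)
  have hweights : ∀ c ∈ codeC D, c ≠ 0 →
      hwt c = 2 ^ ((supp B).card - 1) ∨ hwt c = 2 ^ ((supp A).card - 1) ∨
        hwt c = 2 ^ ((supp B).card - 1) + 2 ^ ((supp A).card - 1) := by
    intro c hc hc0
    rw [← SetLike.mem_coe, coe_codeC_eq_image D hD] at hc
    obtain ⟨u, hu, rfl⟩ := hc
    rw [ne_eq, ← hwt_eq_zero] at hc0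
    rw [hw u hu] at hc0 ⊢
    split_ifs at hc0 ⊢ <;> omega
  have hcountB : {c : ↥D → ZMod 2 | c ∈ codeC D ∧ hwt c = 2 ^ ((supp B).card - 1)}.ncard
      = 2 ^ (supp B).card - 1 := by
    rw [ncard_codeC_hwt_eq h D hD, ← card_deltaT_sdiff_zero]
    congr 1
    ext u
    simp only [Finset.mem_filter, Finset.mem_sdiff, Finset.mem_singleton]
    constructor
    · rintro ⟨hu, hwu⟩
      rw [hw u hu] at hwu
      split_ifs at hwu with h1 h2 h2
      · omega
      · exact ⟨h1, fun h => h2 (h ▸ h0A)⟩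
      · omega
      · omega
    · rintro ⟨hu, hu0⟩
      refine ⟨hSB hu, ?_⟩
      rw [hw u (hSB hu), if_pos hu, if_neg fun hA => hu0 (hzero u hA hu), zero_add]
  refine ⟨?_, finrank_codeC h D hD, ⟨?_, ?_⟩, hcountB, ?_, ?_, hweights⟩
  · have := card_deltaT_union_deltaT h
    rw [hD, Finset.card_sdiff_of_subset
      (Finset.singleton_subset_iff.2 (Finset.mem_union_left _ h0A)), Finset.card_singleton]
    omega
  · have hne : {c : ↥D → ZMod 2 | c ∈ codeC D ∧ hwt c = 2 ^ ((supp B).card - 1)}.Nonempty := by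
      refine Set.nonempty_of_ncard_ne_zero ?_
      rw [hcountB]
      have := Nat.one_lt_two_pow hB.ne'
      omega
    obtain ⟨c, hc, hcw⟩ := hne
    refine ⟨c, hc, fun hc0 => ?_, hcw⟩
    rw [hwt_eq_zero.2 hc0] at hcw
    omega
  · intro c hc hc0
    rcases hweights c hc hc0 with h | h | h <;> omega
  · rw [ncard_codeC_hwt_eq h D hD, ← card_deltaT_sdiff_zero]
    congr 1
    ext u
    simp only [Finset.mem_filter, Finset.mem_sdiff, Finset.mem_singleton]
    constructor
    · rintro ⟨hu, hwu⟩
      rw [hw u hu] at hwu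
      split_ifs at hwu with h1 h2 h2
      · omega
      · omega
      · exact ⟨h2, fun h => h1 (h ▸ h0B)⟩
      · omega
    · rintro ⟨hu, hu0⟩
      refine ⟨hSA hu, ?_⟩
      rw [hw u (hSA hu), if_pos hu, if_neg fun hB => hu0 (hzero u hu hB), add_zero]
  · rw [ncard_codeC_hwt_eq h D hD, ← card_deltaT_union_sdiff h]
    congr 1
    ext u
    simp only [Finset.mem_filter, Finset.mem_sdiff, Finset.mem_union, not_or]
    refine and_congr_right fun hu => ?_
    rw [hw u hu]
    by_cases hA : u ∈ deltaT (supp A) <;> by_cases hB : u ∈ deltaT (supp B) <;>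
      simp only [hA, hB, if_true, if_false, not_true, not_false_iff, and_true, and_false,
        iff_true, iff_false] <;> omega
end

section
/- Let m ≥ 3 and let A, B ∈ F_2^m be such that supp(A) ∩ supp(B) = ∅ and 0 < |B| < |A|. Let D = (Δ_A ∪ Δ_B) \ {0}. Then the dual code C_D^⊥ has length 2^{|A|} + 2^{|B|} − 2, dimension 2^{|A|} + 2^{|B|} − 2 − |A| − |B| over F_2, and minimum distance 3. -/
open Finset

theorem supp_injective {m : ℕ} : Function.Injective (supp (m := m)) := by
  intro u v h
  funext i
  have hi : u i ≠ 0 ↔ v i ≠ 0 := by simpa [supp] using Finset.ext_iff.mp h i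
  generalize u i = a at *
  generalize v i = b at *
  revert a b
  decide

theorem mem_delta {m : ℕ} {A v : Fin m → ZMod 2} : v ∈ delta A ↔ supp v ⊆ supp A := by
  simp [delta]

theorem supp_zero {m : ℕ} : supp (0 : Fin m → ZMod 2) = ∅ := by
  simp [supp]

theorem supp_single {m : ℕ} (i : Fin m) : supp (Pi.single i 1 : Fin m → ZMod 2) = {i} := by
  ext j
  simp [supp, Pi.single_apply]

theorem supp_add_subset {m : ℕ} (u v : Fin m → ZMod 2) : supp (u + v) ⊆ supp u ∪ supp v := by
  intro i
  simp only [supp, mem_filter, mem_univ, true_and, mem_union, Pi.add_apply]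
  contrapose!
  rintro ⟨h1, h2⟩
  simp [h1, h2]

theorem card_delta {m : ℕ} (A : Fin m → ZMod 2) : (delta A).card = 2 ^ wt A := by
  rw [wt, ← card_powerset, ← card_image_of_injective _ supp_injective]
  congr 1
  ext S
  simp only [mem_image, mem_delta, mem_powerset]
  refine ⟨?_, fun hS => ⟨fun i => if i ∈ S then 1 else 0, ?_⟩⟩
  · rintro ⟨v, hv, rfl⟩
    exact hv
  · have : supp (fun i => if i ∈ S then (1 : ZMod 2) else 0) = S := by
      ext i
      simp [supp]
    exact ⟨this.trans_subset hS, this⟩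

theorem delta_inter_delta {m : ℕ} {A B : Fin m → ZMod 2} (h : supp A ∩ supp B = ∅) :
    delta A ∩ delta B = {0} := by
  ext v
  simp only [mem_inter, mem_delta, mem_singleton, ← subset_inter_iff, h, subset_empty]
  rw [← supp_zero (m := m), supp_injective.eq_iff]

theorem card_delta_union_sdiff {m : ℕ} {A B : Fin m → ZMod 2} (h : supp A ∩ supp B = ∅) :
    ((delta A ∪ delta B) \ {0}).card = 2 ^ wt A + 2 ^ wt B - 2 := by
  have h1 := card_union_add_card_inter (delta A) (delta B)
  rw [delta_inter_delta h, card_singleton, card_delta, card_delta] at h1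
  rw [card_sdiff_of_subset, card_singleton]
  · omega
  · simp [mem_delta, supp_zero]

theorem mem_dualCode_codeC {m : ℕ} {D : Finset (Fin m → ZMod 2)} {w : ↥D → ZMod 2} :
    w ∈ dualCode (codeC D) ↔ ∀ i, ∑ g, w g * (g : Fin m → ZMod 2) i = 0 := by
  change (∀ c ∈ codeC D, ∑ g, w g * c g = 0) ↔ _
  simp only [codeC, LinearMap.mem_range, forall_exists_index, forall_apply_eq_imp_iff,
    Matrix.mulVecLin_apply]
  refine ⟨fun h i => ?_, fun h u => ?_⟩
  · simpa using h (Pi.single i 1)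
  · simp only [Matrix.mulVec, dotProduct, Matrix.of_apply, mul_sum]
    rw [sum_comm]
    refine sum_eq_zero fun i _ => ?_
    simp only [← mul_assoc]
    rw [← sum_mul, h i, zero_mul]

/-- If every vector of `D` is supported in `T` and `D` contains the unit vectors of `T`, then
`D` has rank `T.card`. -/
theorem finrank_dualCode_codeC {m : ℕ} {D : Finset (Fin m → ZMod 2)} {T : Finset (Fin m)}
    (hsub : ∀ g ∈ D, supp g ⊆ T) (hunit : ∀ i ∈ T, Pi.single i 1 ∈ D) :
    Module.finrank (ZMod 2) (dualCode (codeC D)) = D.card - T.card := by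
  let M : Matrix T ↥D (ZMod 2) := Matrix.of fun i g => (g : Fin m → ZMod 2) i
  have hker : dualCode (codeC D) = LinearMap.ker M.mulVecLin := by
    ext w
    rw [mem_dualCode_codeC, LinearMap.mem_ker, Matrix.mulVecLin_apply, funext_iff]
    simp only [Matrix.mulVec, dotProduct, M, Matrix.of_apply, Pi.zero_apply, mul_comm (w _)]
    refine ⟨fun h i => h i, fun h i => ?_⟩
    by_cases hi : i ∈ T
    · exact h ⟨i, hi⟩
    · refine sum_eq_zero fun g _ => ?_
      have : (g : Fin m → ZMod 2) i = 0 := by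
        by_contra hne
        exact hi (hsub g g.2 (by simpa [supp] using hne))
      rw [this, zero_mul]
  have hsurj : LinearMap.range M.mulVecLin = ⊤ := by
    rw [eq_top_iff, ← (Pi.basisFun (ZMod 2) T).span_eq, Submodule.span_le]
    rintro _ ⟨i, rfl⟩
    refine ⟨Pi.single ⟨Pi.single (i : Fin m) 1, hunit i i.2⟩ 1, ?_⟩
    rw [Matrix.mulVecLin_apply, Matrix.mulVec_single_one, Pi.basisFun_apply]
    ext j
    simp only [M, Matrix.col_apply, Matrix.of_apply, Pi.single_apply, Subtype.ext_iff]
  have := LinearMap.finrank_range_add_finrank_ker M.mulVecLin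
  rw [hsurj, finrank_top, ← hker, Module.finrank_fintype_fun_eq_card,
    Module.finrank_fintype_fun_eq_card, Fintype.card_coe, Fintype.card_coe] at this
  omega

theorem mem_dualCode_codeC_iff_sum_support {m : ℕ} {D : Finset (Fin m → ZMod 2)}
    {w : ↥D → ZMod 2} :
    w ∈ dualCode (codeC D) ↔ ∑ g with w g ≠ 0, (g : Fin m → ZMod 2) = 0 := by
  have hb : ∀ a b : ZMod 2, a * b = if a ≠ 0 then b else 0 := by decide
  rw [mem_dualCode_codeC, funext_iff]
  refine forall_congr' fun i => ?_
  rw [Finset.sum_apply, sum_filter, Pi.zero_apply]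
  simp only [hb]

theorem three_le_hwt_of_mem_dualCode {m : ℕ} {D : Finset (Fin m → ZMod 2)} (h0 : 0 ∉ D)
    {w : ↥D → ZMod 2} (hw : w ∈ dualCode (codeC D)) (hne : w ≠ 0) : 3 ≤ hwt w := by
  rw [mem_dualCode_codeC_iff_sum_support] at hw
  unfold hwt
  set S : Finset ↥D := univ.filter fun g => w g ≠ 0 with hS
  by_contra! hlt
  have hcard : S.card = 0 ∨ S.card = 1 ∨ S.card = 2 := by omega
  rcases hcard with h | h | h
  · refine hne (funext fun g => ?_)
    by_contra hg
    have : g ∈ S := by simpa [hS] using hg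
    simp [card_eq_zero.mp h] at this
  · obtain ⟨g, hg⟩ := card_eq_one.mp h
    rw [hg, sum_singleton] at hw
    exact h0 (hw ▸ g.2)
  · obtain ⟨g, g', hgg, hg⟩ := card_eq_two.mp h
    rw [hg, sum_pair hgg] at hw
    refine hgg (Subtype.ext ?_)
    rwa [add_eq_zero_iff_eq_neg, ZModModule.neg_eq_self] at hw

theorem exists_mem_dualCode_hwt_eq_three {m : ℕ} {D : Finset (Fin m → ZMod 2)} (h0 : 0 ∉ D)
    {x y : Fin m → ZMod 2} (hx : x ∈ D) (hy : y ∈ D) (hxy : x + y ∈ D) :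
    ∃ w ∈ dualCode (codeC D), w ≠ 0 ∧ hwt w = 3 := by
  have hx0 : x ≠ 0 := fun h => h0 (h ▸ hx)
  have hy0 : y ≠ 0 := fun h => h0 (h ▸ hy)
  have hne : x ≠ y := by
    rintro rfl
    exact h0 (ZModModule.add_self x ▸ hxy)
  let S : Finset ↥D := {⟨x, hx⟩, ⟨y, hy⟩, ⟨x + y, hxy⟩}
  let w : ↥D → ZMod 2 := fun g => if g ∈ S then 1 else 0
  have hw : (univ.filter fun g => w g ≠ 0) = S := by
    ext g
    simp [w]
  have h12 : (⟨x, hx⟩ : ↥D) ∉ ({⟨y, hy⟩, ⟨x + y, hxy⟩} : Finset ↥D) := by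
    simp [hne, hy0]
  have h23 : (⟨y, hy⟩ : ↥D) ≠ ⟨x + y, hxy⟩ := by
    simp [hx0]
  have hcard : hwt w = 3 := by
    rw [hwt, hw, card_insert_of_notMem h12, card_pair h23]
  refine ⟨w, ?_, ?_, hcard⟩
  · rw [mem_dualCode_codeC_iff_sum_support, hw, sum_insert h12, sum_pair h23, ← add_assoc]
    exact ZModModule.add_self (x + y)
  · intro h
    simp [h, hwt] at hcard

theorem stmt6 {m : ℕ} (hm : 3 ≤ m) (A B : Fin m → ZMod 2)
    (hdisj : supp A ∩ supp B = ∅) (hB : 0 < wt B) (hBA : wt B < wt A)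
    (D : Finset (Fin m → ZMod 2)) (hD : D = (delta A ∪ delta B) \ {0}) :
    D.card = 2 ^ wt A + 2 ^ wt B - 2 ∧
    Module.finrank (ZMod 2) (dualCode (codeC D))
      = 2 ^ wt A + 2 ^ wt B - 2 - wt A - wt B ∧
    isMinDist (dualCode (codeC D) : Set (↥D → ZMod 2)) 3 := by
  have hcard : D.card = 2 ^ wt A + 2 ^ wt B - 2 := hD ▸ card_delta_union_sdiff hdisj
  have hmem : ∀ v, v ∈ D ↔ (supp v ⊆ supp A ∨ supp v ⊆ supp B) ∧ v ≠ 0 := by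
    simp [hD, mem_delta]
  have h0 : 0 ∉ D := by simp [hmem]
  have hunit : ∀ i ∈ supp A ∪ supp B, Pi.single i 1 ∈ D := by
    intro i hi
    simpa [hmem, supp_single] using hi
  refine ⟨hcard, ?_, ?_, fun c hc hne => three_le_hwt_of_mem_dualCode h0 hc hne⟩
  · rw [finrank_dualCode_codeC (T := supp A ∪ supp B) _ hunit, hcard,
      card_union_of_disjoint (disjoint_iff_inter_eq_empty.mpr hdisj), Nat.sub_sub _ (wt A)]
    · rfl
    · intro g hg
      rcases ((hmem g).mp hg).1 with h | h
      · exact h.trans subset_union_left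
      · exact h.trans subset_union_right
  · have hA : 1 < (supp A).card := lt_of_le_of_lt hB hBA
    obtain ⟨a, ha, b, hb, hab⟩ := one_lt_card.mp hA
    refine exists_mem_dualCode_hwt_eq_three h0 (hunit a (mem_union_left _ ha))
      (hunit b (mem_union_left _ hb)) ((hmem _).mpr ⟨Or.inl ?_, fun h => ?_⟩)
    · refine (supp_add_subset _ _).trans ?_
      simp [supp_single, insert_subset_iff, ha, hb]
    · have := congrFun h a
      simp [hab] at this
end
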